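/- Let α ≥ 0 be an admissible exponent of A with associated sequence (M_n), and suppose there exists θ > 0 with ‖u‖_α ≤ θ‖G_α u‖_α for all u ∈ c00(α). If n ∈ ℕ and x₀ ∈ E satisfy sup_{m≥n} ‖A(m,n)x₀‖ < ∞, then with L = e^{αθ} one has ‖A(m,n)x₀‖ ≤ (θL/(m−n)) M_n ‖x₀‖ for every integer m > n. -/

import Mathlib

open Filter Topology

variable {E : Type*} [NormedAddCommGroup E] [NormedSpace ℝ E] [CompleteSpace E]

/-- `evol A n m` is the evolution operator `A(m,n) = A_{m-1} ∘ ⋯ ∘ A_n`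
(the identity if `m ≤ n`). -/
def evol (A : ℕ → E →L[ℝ] E) (n : ℕ) : ℕ → E →L[ℝ] E
  | 0 => 1
  | m + 1 => if n ≤ m then A m * evol A n m else 1

/-- `α` is an admissible exponent for `A`: there is a positive sequence `M` with
`‖A(m,n)‖ ≤ M n * e^{α (m - n)}` for all `m ≥ n`. -/
def IsAdmissible (A : ℕ → E →L[ℝ] E) (α : ℝ) : Prop :=
  ∃ M : ℕ → ℝ, (∀ n, 0 < M n) ∧
    ∀ m n : ℕ, n ≤ m → ‖evol A n m‖ ≤ M n * Real.exp (α * ((m : ℝ) - (n : ℝ)))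

/-- The norm `‖x‖_{n,α} = sup_{m ≥ n} e^{-α(m-n)} ‖A(m,n) x‖`. -/
noncomputable def nnorm (A : ℕ → E →L[ℝ] E) (α : ℝ) (n : ℕ) (x : E) : ℝ :=
  ⨆ m : Set.Ici n, Real.exp (-α * (((m : ℕ) : ℝ) - (n : ℝ))) * ‖evol A n (m : ℕ) x‖

/-- Membership in `c00(α)`: `u 0 = 0` and `‖u n‖_{n,α} → 0`. -/
def MemC00 (A : ℕ → E →L[ℝ] E) (α : ℝ) (u : ℕ → E) : Prop :=
  u 0 = 0 ∧ Tendsto (fun n => nnorm A α n (u n)) atTop (𝓝 0)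

/-- The norm `‖u‖_α = sup_n ‖u n‖_{n,α}` on `c00(α)`. -/
noncomputable def cnorm (A : ℕ → E →L[ℝ] E) (α : ℝ) (u : ℕ → E) : ℝ :=
  ⨆ n, nnorm A α n (u n)

/-- The evolution map `T`: `(Tu)_0 = 0`, `(Tu)_{n+1} = A_n u_n`. -/
def Tmap (A : ℕ → E →L[ℝ] E) (u : ℕ → E) : ℕ → E
  | 0 => 0
  | m + 1 => A m (u m)

/-- `G = T - Id`. -/
def Gmap (A : ℕ → E →L[ℝ] E) (u : ℕ → E) : ℕ → E :=
  fun n => Tmap A u n - u n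

theorem evol_self (A : ℕ → E →L[ℝ] E) (n : ℕ) : evol A n n = 1 := by
  cases n <;> simp [evol]

theorem evol_succ (A : ℕ → E →L[ℝ] E) {n m : ℕ} (h : n ≤ m) :
    evol A n (m + 1) = A m * evol A n m := by
  simp [evol, h]

theorem evol_evol (A : ℕ → E →L[ℝ] E) {n j k : ℕ} (hnj : n ≤ j) (hjk : j ≤ k) (x : E) :
    evol A j k (evol A n j x) = evol A n k x := by
  induction k, hjk using Nat.le_induction with
  | base => simp [evol_self]
  | succ k hk ih => simp [evol_succ A hk, evol_succ A (hnj.trans hk), ih]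

theorem nnorm_zero (A : ℕ → E →L[ℝ] E) (α : ℝ) (n : ℕ) : nnorm A α n 0 = 0 := by
  simp [nnorm]

theorem nnorm_nonneg (A : ℕ → E →L[ℝ] E) (α : ℝ) (n : ℕ) (x : E) : 0 ≤ nnorm A α n x :=
  Real.iSup_nonneg fun _ => by positivity

theorem nnorm_smul (A : ℕ → E →L[ℝ] E) (α : ℝ) (n : ℕ) (c : ℝ) (x : E) :
    nnorm A α n (c • x) = |c| * nnorm A α n x := by
  unfold nnorm
  rw [Real.mul_iSup_of_nonneg (abs_nonneg c)]
  congr 1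
  ext m
  rw [map_smul, norm_smul, Real.norm_eq_abs]
  ring

theorem nnorm_le (A : ℕ → E →L[ℝ] E) {α : ℝ} {n : ℕ} {x : E} {C : ℝ}
    (h : ∀ m, n ≤ m → Real.exp (-α * ((m : ℝ) - n)) * ‖evol A n m x‖ ≤ C) :
    nnorm A α n x ≤ C :=
  ciSup_le fun m => h m m.2

theorem norm_le_nnorm {A : ℕ → E →L[ℝ] E} {α C : ℝ} {n : ℕ}
    (h : ∀ m : ℕ, n ≤ m → ‖evol A n m‖ ≤ C * Real.exp (α * ((m : ℝ) - n))) (x : E) :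
    ‖x‖ ≤ nnorm A α n x := by
  have hb : BddAbove (Set.range fun m : Set.Ici n =>
      Real.exp (-α * (((m : ℕ) : ℝ) - (n : ℝ))) * ‖evol A n (m : ℕ) x‖) := by
    refine ⟨C * ‖x‖, ?_⟩
    rintro _ ⟨⟨m, hm⟩, rfl⟩
    calc Real.exp (-α * ((m : ℝ) - n)) * ‖evol A n m x‖
        ≤ Real.exp (-α * ((m : ℝ) - n)) * (C * Real.exp (α * ((m : ℝ) - n)) * ‖x‖) := by
          gcongr
          exact (evol A n m).le_of_opNorm_le (h m hm) x
      _ = Real.exp (-α * ((m : ℝ) - n) + α * ((m : ℝ) - n)) * (C * ‖x‖) := by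
          rw [Real.exp_add]; ring
      _ = C * ‖x‖ := by simp
  simpa [nnorm, evol_self] using le_ciSup hb ⟨n, le_refl n⟩

/-- Testing the lower bound for `G` on a finitely supported multiple of an orbit. -/
theorem abs_mul_nnorm_orbit_le {A : ℕ → E →L[ℝ] E} {α θ : ℝ} (hθ : 0 < θ)
    (hbelow : ∀ u, MemC00 A α u → cnorm A α u ≤ θ * cnorm A α (Gmap A u))
    {n : ℕ} {x₀ : E} {φ : ℕ → ℝ} (hφ0 : ∀ j ≤ n, φ j = 0) (hφ : ∀ᶠ j in atTop, φ j = 0)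
    (hstep : ∀ j, n ≤ j → |φ j - φ (j + 1)| * nnorm A α (j + 1) (evol A n (j + 1) x₀) ≤ 1)
    (m : ℕ) : |φ m| * nnorm A α m (evol A n m x₀) ≤ θ := by
  set u : ℕ → E := fun j => φ j • evol A n j x₀ with hu
  have hlim : Tendsto (fun j => nnorm A α j (u j)) atTop (𝓝 0) := by
    refine tendsto_const_nhds.congr' ?_
    filter_upwards [hφ] with j hj
    simp [hu, hj, nnorm_zero]
  have hG : cnorm A α (Gmap A u) ≤ 1 := by
    refine ciSup_le fun j => ?_
    rcases j with _ | j
    · simp [Gmap, Tmap, hu, hφ0 0 (Nat.zero_le n), nnorm_zero]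
    by_cases hj : n ≤ j
    · have : Gmap A u (j + 1) = (φ j - φ (j + 1)) • evol A n (j + 1) x₀ := by
        simp [Gmap, Tmap, hu, evol_succ A hj, sub_smul]
      rw [this, nnorm_smul]
      exact hstep j hj
    · simp [Gmap, Tmap, hu, hφ0 j (by omega), hφ0 (j + 1) (by omega), nnorm_zero]
  calc |φ m| * nnorm A α m (evol A n m x₀) = nnorm A α m (u m) := (nnorm_smul ..).symm
    _ ≤ cnorm A α u := le_ciSup hlim.bddAbove_range m
    _ ≤ θ * cnorm A α (Gmap A u) := hbelow u ⟨by simp [hu, hφ0 0 (Nat.zero_le n)], hlim⟩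
    _ ≤ θ * 1 := by gcongr
    _ = θ := mul_one θ

theorem sum_inv_nnorm_mul_nnorm_le {A : ℕ → E →L[ℝ] E} {α θ : ℝ} (hθ : 0 < θ)
    (hbelow : ∀ u, MemC00 A α u → cnorm A α u ≤ θ * cnorm A α (Gmap A u))
    {n : ℕ} {x₀ : E} {B : ℝ} (hB : ∀ j, n ≤ j → nnorm A α j (evol A n j x₀) ≤ B) (m : ℕ) :
    (∑ i ∈ Finset.Ioc n m, (nnorm A α i (evol A n i x₀))⁻¹) * nnorm A α m (evol A n m x₀)
      ≤ θ := by
  set N : ℕ → ℝ := fun j => nnorm A α j (evol A n j x₀) with hN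
  have hN0 : ∀ j, 0 ≤ N j := fun j => nnorm_nonneg ..
  have hB0 : 0 ≤ B := (hN0 n).trans (hB n le_rfl)
  set S : ℕ → ℝ := fun j => ∑ i ∈ Finset.Ioc n j, (N i)⁻¹ with hS
  have hS0 : ∀ j, 0 ≤ S j := fun j => Finset.sum_nonneg fun i _ => inv_nonneg.2 (hN0 i)
  set ε : ℝ := (B + 1)⁻¹ with hε
  have hε0 : 0 < ε := by positivity
  have hεB : ε * B ≤ 1 := by
    rw [hε, inv_mul_le_iff₀ (by positivity)]; linarith
  set φ : ℕ → ℝ := fun j => max 0 (S (min j m) - ε * ((j - m : ℕ) : ℝ)) with hφ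
  have hφle : ∀ j ≤ m, φ j = S j := fun j hj => by
    simp [hφ, hj, hS0]
  have h := abs_mul_nnorm_orbit_le (x₀ := x₀) (φ := φ) hθ hbelow (n := n) ?_ ?_ ?_ m
  · rwa [hφle m le_rfl, abs_of_nonneg (hS0 m)] at h
  · intro j hj
    have : S (min j m) = 0 := by
      simp [hS, Finset.Ioc_eq_empty_of_le ((min_le_left j m).trans hj)]
    simp only [hφ, this]
    refine max_eq_left ?_
    have : 0 ≤ ε * ((j - m : ℕ) : ℝ) := by positivity
    linarith
  · obtain ⟨k, hk⟩ := exists_nat_ge (S m / ε)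
    filter_upwards [eventually_ge_atTop (m + k)] with j hj
    refine max_eq_left ?_
    rw [min_eq_right (by omega), sub_nonpos, mul_comm, ← div_le_iff₀ hε0]
    exact hk.trans (by exact_mod_cast (by omega : k ≤ j - m))
  · intro j hj
    change |φ j - φ (j + 1)| * N (j + 1) ≤ 1
    by_cases hjm : j + 1 ≤ m
    · rw [hφle j (by omega), hφle _ hjm]
      have : S (j + 1) = S j + (N (j + 1))⁻¹ := Finset.sum_Ioc_succ_top hj _
      rw [this, sub_add_cancel_left, abs_neg, abs_of_nonneg (inv_nonneg.2 (hN0 _))]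
      exact inv_mul_le_one
    · have hsub : ((j + 1 - m : ℕ) : ℝ) = ((j - m : ℕ) : ℝ) + 1 := by
        rw [Nat.sub_add_comm (by omega)]; push_cast; ring
      have hle : |φ j - φ (j + 1)| ≤ ε := by
        simp only [hφ, hsub, min_eq_right (by omega : m ≤ j), min_eq_right (by omega : m ≤ j + 1)]
        refine (abs_max_sub_max_le_max _ _ _ _).trans ?_
        rw [show S m - ε * ((j - m : ℕ) : ℝ) - (S m - ε * (((j - m : ℕ) : ℝ) + 1)) = ε by ring,
          abs_of_pos hε0]
        simp [hε0.le]
      calc |φ j - φ (j + 1)| * N (j + 1) ≤ ε * B :=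
            mul_le_mul hle (hB _ (by omega)) (hN0 _) hε0.le
        _ ≤ 1 := hεB

/-- Under the lower bound `‖u‖_α ≤ θ ‖G_α u‖_α` on `c00(α)` with `α ≥ 0`
admissible with sequence `(M_n)`, every bounded orbit satisfies, with `L = e^{αθ}`,
`‖A(m,n) x₀‖ ≤ (θ L/(m-n)) M_n ‖x₀‖` for every `m > n`. -/
theorem stmt11 (A : ℕ → E →L[ℝ] E) (α : ℝ) (hα0 : 0 ≤ α) (M : ℕ → ℝ)
    (hM : ∀ n, 0 < M n)
    (hbd : ∀ m n : ℕ, n ≤ m → ‖evol A n m‖ ≤ M n * Real.exp (α * ((m : ℝ) - (n : ℝ))))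
    (θ : ℝ) (hθ : 0 < θ)
    (hbelow : ∀ u, MemC00 A α u → cnorm A α u ≤ θ * cnorm A α (Gmap A u))
    (n : ℕ) (x₀ : E)
    (hbdd : BddAbove (Set.range fun m : Set.Ici n => ‖evol A n (m : ℕ) x₀‖)) :
    ∀ m : ℕ, n < m →
      ‖evol A n m x₀‖ ≤
        θ * Real.exp (α * θ) / ((m : ℝ) - (n : ℝ)) * M n * ‖x₀‖ := by
  set N : ℕ → ℝ := fun j => nnorm A α j (evol A n j x₀) with hN
  have hN0 : ∀ j, 0 ≤ N j := fun j => nnorm_nonneg ..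
  have hnorm : ∀ j, ‖evol A n j x₀‖ ≤ N j := fun j => norm_le_nnorm (fun m hm => hbd m j hm) _
  obtain ⟨B, hB⟩ := hbdd
  have hNB : ∀ j, n ≤ j → N j ≤ B := fun j hj => nnorm_le A fun k hk => by
    rw [evol_evol A hj hk]
    have hk' : (j : ℝ) ≤ k := by exact_mod_cast hk
    have hexp : Real.exp (-α * ((k : ℝ) - j)) ≤ 1 :=
      Real.exp_le_one_iff.2 (by nlinarith)
    exact (mul_le_of_le_one_left (norm_nonneg _) hexp).trans (hB ⟨⟨k, hj.trans hk⟩, rfl⟩)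
  have hgrowth : ∀ j, n ≤ j → N j ≤ Real.exp (α * ((j : ℝ) - n)) * (M n * ‖x₀‖) :=
    fun j hj => nnorm_le A fun k hk => by
      rw [evol_evol A hj hk]
      calc Real.exp (-α * ((k : ℝ) - j)) * ‖evol A n k x₀‖
          ≤ Real.exp (-α * ((k : ℝ) - j)) * (M n * Real.exp (α * ((k : ℝ) - n)) * ‖x₀‖) := by
            gcongr
            exact (evol A n k).le_of_opNorm_le (hbd k n (hj.trans hk)) x₀
        _ = Real.exp (-α * ((k : ℝ) - j) + α * ((k : ℝ) - n)) * (M n * ‖x₀‖) := by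
            rw [Real.exp_add]; ring
        _ = Real.exp (α * ((j : ℝ) - n)) * (M n * ‖x₀‖) := by
            congr 2; ring
  have hpos : ∀ i j, n ≤ i → i ≤ j → 0 < N j → 0 < N i := fun i j hi hij hj => by
    refine (hN0 i).lt_of_ne' fun h0 => hj.ne' ?_
    have hx : evol A n i x₀ = 0 := norm_le_zero_iff.1 ((hnorm i).trans h0.le)
    simp only [hN, ← evol_evol A hi hij, hx, map_zero, nnorm_zero]
  have hsum : ∀ m, (∑ i ∈ Finset.Ioc n m, (N i)⁻¹) * N m ≤ θ :=
    sum_inv_nnorm_mul_nnorm_le hθ hbelow hNB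
  set K : ℝ := Real.exp (α * θ) * (M n * ‖x₀‖) with hK
  have hK0 : 0 ≤ K := by have := hM n; positivity
  have hcount : ∀ (m : ℕ) (C : ℝ), n < m → 0 < N m → (∀ i ∈ Finset.Ioc n m, N i ≤ C) →
      ((m : ℝ) - n) * N m ≤ θ * C := fun m C hm hNm hC => by
    have hCpos : 0 < C := hNm.trans_le (hC m (Finset.mem_Ioc.2 ⟨hm, le_rfl⟩))
    have hcard : ((m : ℝ) - n) * C⁻¹ ≤ ∑ i ∈ Finset.Ioc n m, (N i)⁻¹ := by
      have := Finset.card_nsmul_le_sum (Finset.Ioc n m) (fun i => (N i)⁻¹) C⁻¹ fun i hi =>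
        inv_anti₀ (hpos i m (Finset.mem_Ioc.1 hi).1.le (Finset.mem_Ioc.1 hi).2 hNm) (hC i hi)
      rwa [Nat.card_Ioc, nsmul_eq_mul, Nat.cast_sub hm.le] at this
    have h := (mul_le_mul_of_nonneg_right hcard hNm.le).trans (hsum m)
    calc ((m : ℝ) - n) * N m = ((m : ℝ) - n) * C⁻¹ * N m * C := by field_simp
      _ ≤ θ * C := by gcongr
  have hNK : ∀ j, n < j → N j ≤ K := by
    intro j
    induction j using Nat.strong_induction_on with
    | _ j ih =>
      intro hj
      by_contra! hlt
      have hNj : 0 < N j := hK0.trans_lt hlt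
      have hle : (j : ℝ) - n ≤ θ := by
        refine le_of_mul_le_mul_right (hcount j (N j) hj hNj fun i hi => ?_) hNj
        obtain ⟨h1, h2⟩ := Finset.mem_Ioc.1 hi
        rcases h2.lt_or_eq with h2 | rfl
        · exact (ih i h2 h1).trans hlt.le
        · exact le_rfl
      refine hlt.not_ge ((hgrowth j hj.le).trans ?_)
      have := hM n
      rw [hK]
      gcongr
  intro m hm
  have hmn : (0 : ℝ) < (m : ℝ) - n := sub_pos.2 (by exact_mod_cast hm)
  have hmain : ((m : ℝ) - n) * N m ≤ θ * K := by
    rcases (hN0 m).eq_or_lt with h0 | h0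
    · rw [← h0, mul_zero]; positivity
    · exact hcount m K hm h0 fun i hi => hNK i (Finset.mem_Ioc.1 hi).1
  calc ‖evol A n m x₀‖ ≤ N m := hnorm m
    _ ≤ θ * K / ((m : ℝ) - n) := by rwa [le_div_iff₀' hmn]
    _ = θ * Real.exp (α * θ) / ((m : ℝ) - (n : ℝ)) * M n * ‖x₀‖ := by rw [hK]; ring
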